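/- arXiv:1206.6596 — 2 statements merged into one kernel-verified Lean document; each statement's English description precedes it below -/
import Mathlib

section
/- There exists a ℤ[δ,δ⁻¹]-algebra homomorphism φ : Br(F4) → Br(E6) with φ(r_1) = R_1R_6, φ(r_2) = R_3R_5, φ(r_3) = R_4, φ(r_4) = R_2, φ(e_1) = E_1E_6, φ(e_2) = E_3E_5, φ(e_3) = E_4, φ(e_4) = E_2. -/
open LaurentPolynomial

/-- The base ring `ℤ[δ, δ⁻¹]` of Laurent polynomials over `ℤ`. -/
abbrev Rring : Type := LaurentPolynomial ℤ

/-- The distinguished invertible element `δ`. -/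
noncomputable def δ : Rring := LaurentPolynomial.T 1

/-- Generators of the Brauer algebra of type F₄: `r i` and `e i` for the four nodes
(the node `i : Fin 4` corresponds to the node `i+1` in the usual 1-based labelling). -/
inductive GenF4 : Type
  | r : Fin 4 → GenF4
  | e : Fin 4 → GenF4

namespace BrF4rel

/-- `R i` in the free algebra. -/
noncomputable abbrev R (i : Fin 4) : FreeAlgebra Rring GenF4 := FreeAlgebra.ι Rring (GenF4.r i)
/-- `E i` in the free algebra. -/
noncomputable abbrev E (i : Fin 4) : FreeAlgebra Rring GenF4 := FreeAlgebra.ι Rring (GenF4.e i)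

/-- Non-adjacent (0-based) pairs of nodes of the F₄ diagram: `{1,3}, {1,4}, {2,4}` 1-based. -/
def nadj (i j : Fin 4) : Prop :=
  (i, j) ∈ ([(0, 2), (2, 0), (0, 3), (3, 0), (1, 3), (3, 1)] : List (Fin 4 × Fin 4))

/-- Simply bonded (0-based) pairs of nodes of the F₄ diagram: `{1,2}, {3,4}` 1-based. -/
def sadj (i j : Fin 4) : Prop :=
  (i, j) ∈ ([(0, 1), (1, 0), (2, 3), (3, 2)] : List (Fin 4 × Fin 4))

/-- The defining relations of the Brauer algebra of type F₄ (0-based node labels: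
node `i` here is node `i+1` in the paper). -/
inductive rel : FreeAlgebra Rring GenF4 → FreeAlgebra Rring GenF4 → Prop
  | rr (i : Fin 4) : rel (R i * R i) 1
  | re (i : Fin 4) : rel (R i * E i) (E i)
  | er (i : Fin 4) : rel (E i * R i) (E i)
  | ee_short (i : Fin 4) (h : i = 2 ∨ i = 3) : rel (E i * E i) (δ • E i)
  | ee_long (i : Fin 4) (h : i = 0 ∨ i = 1) : rel (E i * E i) ((δ ^ 2) • E i)
  | rr_comm {i j : Fin 4} (h : nadj i j) : rel (R i * R j) (R j * R i)
  | er_comm {i j : Fin 4} (h : nadj i j) : rel (E i * R j) (R j * E i)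
  | ee_comm {i j : Fin 4} (h : nadj i j) : rel (E i * E j) (E j * E i)
  | braid {i j : Fin 4} (h : sadj i j) : rel (R i * R j * R i) (R j * R i * R j)
  | rre {i j : Fin 4} (h : sadj i j) : rel (R j * R i * E j) (E i * E j)
  | rer {i j : Fin 4} (h : sadj i j) : rel (R i * E j * R i) (R j * E i * R j)
  | db1 : rel (R 1 * R 2 * R 1 * R 2) (R 2 * R 1 * R 2 * R 1)
  | db2 : rel (R 1 * R 2 * E 1) (R 2 * E 1)
  | db3 : rel (R 1 * E 2 * R 1 * E 2) (E 2 * E 1 * E 2)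
  | db4 : rel (R 1 * R 2 * R 1 * E 2) (E 2 * (R 1 * R 2 * R 1))
  | db5 : rel (E 1 * R 2 * E 1) (δ • E 1)
  | db6 : rel (E 1 * E 2 * E 1) (δ • E 1)
  | db7 : rel (E 1 * R 2 * R 1) (E 1 * R 2)
  | db8 : rel (E 1 * E 2 * R 1) (E 1 * E 2)

end BrF4rel

/-- The Brauer algebra of type F₄ over `ℤ[δ, δ⁻¹]`. -/
noncomputable abbrev BrF4 : Type := RingQuot BrF4rel.rel

/-- The generator `r i` (0-based) of `BrF4`. -/
noncomputable def rgen (i : Fin 4) : BrF4 :=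
  RingQuot.mkAlgHom Rring BrF4rel.rel (BrF4rel.R i)

/-- The generator `e i` (0-based) of `BrF4`. -/
noncomputable def egen (i : Fin 4) : BrF4 :=
  RingQuot.mkAlgHom Rring BrF4rel.rel (BrF4rel.E i)

/-- Generators of the Brauer algebra of type E₆: `R i` and `E i` for the six nodes
(the node `i : Fin 6` corresponds to the node `i+1` in the usual 1-based labelling). -/
inductive GenE6 : Type
  | r : Fin 6 → GenE6
  | e : Fin 6 → GenE6

namespace BrE6rel

noncomputable abbrev R (i : Fin 6) : FreeAlgebra Rring GenE6 := FreeAlgebra.ι Rring (GenE6.r i)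
noncomputable abbrev E (i : Fin 6) : FreeAlgebra Rring GenE6 := FreeAlgebra.ι Rring (GenE6.e i)

/-- Adjacent (0-based) pairs of nodes of the E₆ diagram,
whose edges are (1-based) `{1,3}, {3,4}, {4,5}, {5,6}, {2,4}`. -/
def adj (i j : Fin 6) : Prop :=
  (i, j) ∈ ([(0, 2), (2, 0), (2, 3), (3, 2), (3, 4), (4, 3), (4, 5), (5, 4), (1, 3), (3, 1)] :
    List (Fin 6 × Fin 6))

/-- Non-adjacent pairs: distinct non-adjacent nodes. -/
def nadj (i j : Fin 6) : Prop := i ≠ j ∧ ¬ adj i j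

/-- The defining relations of the Brauer algebra of type E₆ (0-based node labels). -/
inductive rel : FreeAlgebra Rring GenE6 → FreeAlgebra Rring GenE6 → Prop
  | rr (i : Fin 6) : rel (R i * R i) 1
  | re (i : Fin 6) : rel (R i * E i) (E i)
  | er (i : Fin 6) : rel (E i * R i) (E i)
  | ee (i : Fin 6) : rel (E i * E i) (δ • E i)
  | rr_comm {i j : Fin 6} (h : nadj i j) : rel (R i * R j) (R j * R i)
  | er_comm {i j : Fin 6} (h : nadj i j) : rel (E i * R j) (R j * E i)
  | ee_comm {i j : Fin 6} (h : nadj i j) : rel (E i * E j) (E j * E i)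
  | braid {i j : Fin 6} (h : adj i j) : rel (R i * R j * R i) (R j * R i * R j)
  | rre {i j : Fin 6} (h : adj i j) : rel (R j * R i * E j) (E i * E j)
  | rer {i j : Fin 6} (h : adj i j) : rel (R i * E j * R i) (R j * E i * R j)

end BrE6rel

/-- The Brauer algebra of type E₆ over `ℤ[δ, δ⁻¹]`. -/
noncomputable abbrev BrE6 : Type := RingQuot BrE6rel.rel

/-- The generator `R i` (0-based) of `BrE6`. -/
noncomputable def Rgen (i : Fin 6) : BrE6 :=
  RingQuot.mkAlgHom Rring BrE6rel.rel (BrE6rel.R i)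

/-- The generator `E i` (0-based) of `BrE6`. -/
noncomputable def Egen (i : Fin 6) : BrE6 :=
  RingQuot.mkAlgHom Rring BrE6rel.rel (BrE6rel.E i)

/-- A pair `(r, e)` of a reflection and a Temperley–Lieb element attached to one node. -/
structure BrauerNode {A : Type*} [Monoid A] (r e : A) : Prop where
  rr : r * r = 1
  re : r * e = e
  er : e * r = e

/-- The relations between the pairs `(r, e)` and `(s, f)` attached to simply bonded nodes. -/
structure BrauerBond {A : Type*} [Monoid A] (r e s f : A) : Prop where
  braid : r * s * r = s * r * s
  rre : s * r * f = e * f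
  rre' : r * s * e = f * e
  rer : r * f * r = s * e * s

/-- The pairs `(r, e)` and `(s, f)` commute elementwise. -/
structure BrauerCommute {A : Type*} [Monoid A] (r e s f : A) : Prop where
  rr : Commute r s
  er : Commute e s
  re : Commute r f
  ee : Commute e f

section Monoid

variable {A : Type*} [Monoid A] {r e s f r' e' s' f' : A}

namespace BrauerNode

theorem mul (h : BrauerNode r e) (h' : BrauerNode r' e') (hc : BrauerCommute r e r' e') :
    BrauerNode (r * r') (e * e') where
  rr := by rw [hc.rr.symm.mul_mul_mul_comm, h.rr, h'.rr, one_mul]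
  re := by rw [hc.er.symm.mul_mul_mul_comm, h.re, h'.re]
  er := by rw [hc.re.symm.mul_mul_mul_comm, h.er, h'.er]

end BrauerNode

namespace BrauerCommute

theorem symm (h : BrauerCommute r e s f) : BrauerCommute s f r e :=
  ⟨h.rr.symm, h.re.symm, h.er.symm, h.ee.symm⟩

theorem mul_left (h : BrauerCommute r e s f) (h' : BrauerCommute r' e' s f) :
    BrauerCommute (r * r') (e * e') s f :=
  ⟨h.rr.mul_left h'.rr, h.er.mul_left h'.er, h.re.mul_left h'.re, h.ee.mul_left h'.ee⟩

end BrauerCommute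

namespace BrauerBond

theorem symm (h : BrauerBond r e s f) : BrauerBond s f r e :=
  ⟨h.braid.symm, h.rre', h.rre, h.rer.symm⟩

theorem mul (h : BrauerBond r e s f) (h' : BrauerBond r' e' s' f')
    (hrr : BrauerCommute r e r' e') (hrs : BrauerCommute r e s' f')
    (hsr : BrauerCommute s f r' e') (hss : BrauerCommute s f s' f') :
    BrauerBond (r * r') (e * e') (s * s') (f * f') where
  braid := by
    rw [hsr.rr.symm.mul_mul_mul_comm, (hrr.rr.mul_right hrs.rr).symm.mul_mul_mul_comm,
      hrs.rr.symm.mul_mul_mul_comm, (hss.rr.mul_right hsr.rr).symm.mul_mul_mul_comm,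
      h.braid, h'.braid]
  rre := by
    rw [hrs.rr.symm.mul_mul_mul_comm, (hss.er.mul_right hsr.er).symm.mul_mul_mul_comm,
      hsr.ee.symm.mul_mul_mul_comm, h.rre, h'.rre]
  rre' := by
    rw [hsr.rr.symm.mul_mul_mul_comm, (hrr.er.mul_right hrs.er).symm.mul_mul_mul_comm,
      hrs.ee.symm.mul_mul_mul_comm, h.rre', h'.rre']
  rer := by
    rw [hsr.er.symm.mul_mul_mul_comm, (hrr.rr.mul_right hrs.re).symm.mul_mul_mul_comm,
      hrs.er.symm.mul_mul_mul_comm, (hss.rr.mul_right hsr.re).symm.mul_mul_mul_comm,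
      h.rer, h'.rer]

theorem mul_swap (h : BrauerBond r e s f) (hr : BrauerNode r e) (hs : BrauerNode s f) :
    e * s * r = e * f :=
  calc e * s * r = s * (s * e * s) * r := by simp only [← mul_assoc, hs.rr, one_mul]
    _ = s * r * f * (r * r) := by rw [← h.rer]; simp only [mul_assoc]
    _ = e * f := by rw [hr.rr, mul_one, h.rre]

theorem mul_e_mul (h : BrauerBond r e s f) (hr : BrauerNode r e) (hs : BrauerNode s f) :
    e * f * e = e :=
  calc e * f * e = s * r * (f * e) := by rw [← h.rre, mul_assoc]
    _ = s * (r * r) * s * e := by rw [← h.rre']; simp only [mul_assoc]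
    _ = e := by rw [hr.rr, mul_one, hs.rr, one_mul]

theorem mul_r_mul (h : BrauerBond r e s f) (hr : BrauerNode r e) (hs : BrauerNode s f) :
    e * s * e = e := by
  have := h.mul_e_mul hr hs
  rwa [← h.mul_swap hr hs, mul_assoc (e * s), hr.re] at this

end BrauerBond

end Monoid

/-- Three nodes of type `A₃`, the middle one carrying `(c, z)`. -/
structure BrauerPath {A : Type*} [Monoid A] (a x c z b y : A) : Prop where
  left : BrauerNode a x
  mid : BrauerNode c z
  right : BrauerNode b y
  bondLeft : BrauerBond a x c z
  bondRight : BrauerBond b y c z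
  comm : BrauerCommute a x b y

namespace BrauerPath

variable {A : Type*} [Ring A] {a x c z b y : A}

theorem braid (h : BrauerPath a x c z b y) :
    a * b * c * (a * b) * c = c * (a * b) * c * (a * b) := by
  have h1 := h.bondLeft.braid
  have h2 := h.bondRight.braid
  have h3 := h.comm.rr.eq
  linear_combination (norm := noncomm_ring) a * b * c * h3 * c + a * h2 * a * c - a * c * b * h1
    - a * c * h3 * c * a + h1 * b * c * a - c * a * h2 * a - c * a * b * c * h3

theorem rre (h : BrauerPath a x c z b y) : a * b * c * (x * y) = c * (x * y) := by
  have h1 := h.bondLeft.rre'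
  have h2 := h.bondRight.rre
  have h3 := h.comm.rr.eq
  have h4 := h.comm.ee.eq
  have h5 := h.bondRight.rre'
  have h6 := h.right.rr
  linear_combination (norm := noncomm_ring) h3 * c * x * y + b * h1 * y + b * z * h4
    - b * h5 * x + h6 * c * y * x - c * h4

theorem err (h : BrauerPath a x c z b y) : x * y * c * (a * b) = x * y * c := by
  have h1 := h.bondLeft.mul_swap h.left h.mid
  have h2 := h.bondRight.mul_swap h.right h.mid
  have h3 := h.comm.rr.eq
  have h4 := h.comm.ee.eq
  have h6 := h.left.rr
  linear_combination (norm := noncomm_ring) x * y * c * h3 + x * h2 * a + h4 * z * a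
    - y * h1 * a + y * x * c * h6 - h4 * c

theorem eer (h : BrauerPath a x c z b y) : x * y * z * (a * b) = x * y * z := by
  have h1 := h.bondLeft.mul_swap h.left h.mid
  have h2 := h.bondRight.mul_swap h.right h.mid
  have h3 := h.comm.rr.eq
  have h4 := h.comm.ee.eq
  have h5 := h.right.rr
  have h6 := h.left.rr
  linear_combination (norm := noncomm_ring) -x * h2 * a * b + x * y * c * b * h3
    + x * y * c * h5 * a + h4 * c * a + y * h1 - h4 * z

theorem rere (h : BrauerPath a x c z b y) : a * b * z * (a * b) * z = z * (x * y) * z := by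
  have h1 := h.bondLeft.rre
  have h2 := h.bondRight.rer
  have h3 := h.comm.rr.eq
  have h4 := h.comm.ee.eq
  have h5 := h.bondLeft.rre'
  linear_combination (norm := noncomm_ring) a * b * z * h3 * z + a * h2 * a * z
    + a * c * y * h1 - a * c * h4 * z + h5 * y * z

theorem rrre (h : BrauerPath a x c z b y) :
    a * b * c * (a * b) * z = z * (a * b * c * (a * b)) := by
  have h1 := h.bondLeft.mul_swap h.left h.mid
  have h2 := h.bondRight.braid
  have h3 := h.comm.rr.eq
  have h4 := h.comm.er.eq
  have h5 := h.bondLeft.rre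
  have h6 := h.bondLeft.rre'
  have h7 := h.bondLeft.symm.mul_swap h.mid h.left
  linear_combination (norm := noncomm_ring) a * b * c * h3 * z + a * h2 * a * z + a * c * b * h5
    - a * c * h4 * z + h6 * b * z - z * a * b * c * h3 - z * a * h2 * a - h7 * b * c * a
    - z * h4 * c * a - z * b * h1 + z * h4 * z

theorem ere (h : BrauerPath a x c z b y) : x * y * c * (x * y) = x * x * y := by
  have h1 := h.bondRight.mul_r_mul h.right h.mid
  have h2 := h.comm.ee.eq
  linear_combination (norm := noncomm_ring) x * y * c * h2 + x * h1 * x - x * h2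

theorem eee (h : BrauerPath a x c z b y) : x * y * z * (x * y) = x * x * y := by
  have h1 := h.bondRight.mul_e_mul h.right h.mid
  have h2 := h.comm.ee.eq
  linear_combination (norm := noncomm_ring) x * y * z * h2 + x * h1 * x - x * h2

end BrauerPath

instance (i j : Fin 6) : Decidable (BrE6rel.adj i j) :=
  inferInstanceAs (Decidable (_ ∈ _))

instance (i j : Fin 6) : Decidable (BrE6rel.nadj i j) :=
  inferInstanceAs (Decidable (_ ∧ _))

theorem brauerNode_gen (i : Fin 6) : BrauerNode (Rgen i) (Egen i) where
  rr := by simpa [Rgen] using RingQuot.mkAlgHom_rel Rring (BrE6rel.rel.rr i)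
  re := by simpa [Rgen, Egen] using RingQuot.mkAlgHom_rel Rring (BrE6rel.rel.re i)
  er := by simpa [Rgen, Egen] using RingQuot.mkAlgHom_rel Rring (BrE6rel.rel.er i)

theorem Egen_mul_self (i : Fin 6) : Egen i * Egen i = δ • Egen i := by
  simpa [Egen] using RingQuot.mkAlgHom_rel Rring (BrE6rel.rel.ee i)

theorem BrE6rel.adj.symm {i j : Fin 6} (h : BrE6rel.adj i j) : BrE6rel.adj j i := by
  revert i j
  decide

theorem brauerCommute_gen {i j : Fin 6} (h : BrE6rel.nadj i j) :
    BrauerCommute (Rgen i) (Egen i) (Rgen j) (Egen j) where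
  rr := by simpa [Rgen, Commute, SemiconjBy] using
    RingQuot.mkAlgHom_rel Rring (BrE6rel.rel.rr_comm h)
  er := by simpa [Rgen, Egen, Commute, SemiconjBy] using
    RingQuot.mkAlgHom_rel Rring (BrE6rel.rel.er_comm h)
  re := by
    have h' : BrE6rel.nadj j i := ⟨h.1.symm, fun hji => h.2 hji.symm⟩
    simpa [Rgen, Egen, Commute, SemiconjBy] using
      (RingQuot.mkAlgHom_rel Rring (BrE6rel.rel.er_comm h')).symm
  ee := by simpa [Egen, Commute, SemiconjBy] using
    RingQuot.mkAlgHom_rel Rring (BrE6rel.rel.ee_comm h)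

theorem brauerBond_gen {i j : Fin 6} (h : BrE6rel.adj i j) :
    BrauerBond (Rgen i) (Egen i) (Rgen j) (Egen j) where
  braid := by simpa [Rgen] using RingQuot.mkAlgHom_rel Rring (BrE6rel.rel.braid h)
  rre := by simpa [Rgen, Egen] using RingQuot.mkAlgHom_rel Rring (BrE6rel.rel.rre h)
  rre' := by simpa [Rgen, Egen] using RingQuot.mkAlgHom_rel Rring (BrE6rel.rel.rre h.symm)
  rer := by simpa [Rgen, Egen] using RingQuot.mkAlgHom_rel Rring (BrE6rel.rel.rer h)

/-- The images in `BrE6` of the generators `r i` of `BrF4`. -/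
noncomputable def foldR : Fin 4 → BrE6 := ![Rgen 0 * Rgen 5, Rgen 2 * Rgen 4, Rgen 3, Rgen 1]

/-- The images in `BrE6` of the generators `e i` of `BrF4`. -/
noncomputable def foldE : Fin 4 → BrE6 := ![Egen 0 * Egen 5, Egen 2 * Egen 4, Egen 3, Egen 1]

theorem brauerNode_fold (i : Fin 4) : BrauerNode (foldR i) (foldE i) := by
  fin_cases i
  · exact (brauerNode_gen 0).mul (brauerNode_gen 5) (brauerCommute_gen (by decide))
  · exact (brauerNode_gen 2).mul (brauerNode_gen 4) (brauerCommute_gen (by decide))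
  · exact brauerNode_gen 3
  · exact brauerNode_gen 1

theorem brauerCommute_fold {i j : Fin 4} (h : BrF4rel.nadj i j) :
    BrauerCommute (foldR i) (foldE i) (foldR j) (foldE j) := by
  have h02 : BrauerCommute (foldR 0) (foldE 0) (foldR 2) (foldE 2) :=
    (brauerCommute_gen (by decide)).mul_left (brauerCommute_gen (by decide))
  have h03 : BrauerCommute (foldR 0) (foldE 0) (foldR 3) (foldE 3) :=
    (brauerCommute_gen (by decide)).mul_left (brauerCommute_gen (by decide))
  have h13 : BrauerCommute (foldR 1) (foldE 1) (foldR 3) (foldE 3) :=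
    (brauerCommute_gen (by decide)).mul_left (brauerCommute_gen (by decide))
  simp only [BrF4rel.nadj, List.mem_cons, Prod.mk.injEq, List.not_mem_nil, or_false] at h
  rcases h with ⟨rfl, rfl⟩ | ⟨rfl, rfl⟩ | ⟨rfl, rfl⟩ | ⟨rfl, rfl⟩ | ⟨rfl, rfl⟩ | ⟨rfl, rfl⟩
  exacts [h02, h02.symm, h03, h03.symm, h13, h13.symm]

theorem brauerBond_fold {i j : Fin 4} (h : BrF4rel.sadj i j) :
    BrauerBond (foldR i) (foldE i) (foldR j) (foldE j) := by
  have h01 : BrauerBond (foldR 0) (foldE 0) (foldR 1) (foldE 1) :=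
    (brauerBond_gen (by decide)).mul (brauerBond_gen (by decide)) (brauerCommute_gen (by decide))
      (brauerCommute_gen (by decide)) (brauerCommute_gen (by decide))
      (brauerCommute_gen (by decide))
  have h23 : BrauerBond (foldR 2) (foldE 2) (foldR 3) (foldE 3) := brauerBond_gen (by decide)
  simp only [BrF4rel.sadj, List.mem_cons, Prod.mk.injEq, List.not_mem_nil, or_false] at h
  rcases h with ⟨rfl, rfl⟩ | ⟨rfl, rfl⟩ | ⟨rfl, rfl⟩ | ⟨rfl, rfl⟩
  exacts [h01, h01.symm, h23, h23.symm]

theorem brauerPath_gen : BrauerPath (Rgen 2) (Egen 2) (Rgen 3) (Egen 3) (Rgen 4) (Egen 4) where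
  left := brauerNode_gen 2
  mid := brauerNode_gen 3
  right := brauerNode_gen 4
  bondLeft := brauerBond_gen (by decide)
  bondRight := brauerBond_gen (by decide)
  comm := brauerCommute_gen (by decide)

theorem foldE_mul_self_short {i : Fin 4} (h : i = 2 ∨ i = 3) :
    foldE i * foldE i = δ • foldE i := by
  rcases h with rfl | rfl <;> exact Egen_mul_self _

theorem Egen_mul_Egen_mul_self {i j : Fin 6} (h : BrE6rel.nadj i j) :
    Egen i * Egen j * (Egen i * Egen j) = δ ^ 2 • (Egen i * Egen j) := by
  rw [(brauerCommute_gen h).ee.symm.mul_mul_mul_comm, Egen_mul_self, Egen_mul_self,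
    smul_mul_smul_comm, sq]

theorem foldE_mul_self_long {i : Fin 4} (h : i = 0 ∨ i = 1) :
    foldE i * foldE i = δ ^ 2 • foldE i := by
  rcases h with rfl | rfl <;> exact Egen_mul_Egen_mul_self (by decide)

/-- The map `GenF4 → BrE6` extended to the free algebra. -/
noncomputable def foldFree : FreeAlgebra Rring GenF4 →ₐ[Rring] BrE6 :=
  FreeAlgebra.lift Rring fun
    | .r i => foldR i
    | .e i => foldE i

theorem foldFree_R (i : Fin 4) : foldFree (BrF4rel.R i) = foldR i :=
  FreeAlgebra.lift_ι_apply ..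

theorem foldFree_E (i : Fin 4) : foldFree (BrF4rel.E i) = foldE i :=
  FreeAlgebra.lift_ι_apply ..

theorem foldFree_rel ⦃u v : FreeAlgebra Rring GenF4⦄ (h : BrF4rel.rel u v) :
    foldFree u = foldFree v := by
  have hδ : Egen 2 * Egen 2 * Egen 4 = δ • (Egen 2 * Egen 4) := by
    rw [Egen_mul_self, smul_mul_assoc]
  induction h <;> simp only [map_mul, map_one, map_smul, foldFree_R, foldFree_E]
  case rr i => exact (brauerNode_fold i).rr
  case re i => exact (brauerNode_fold i).re
  case er i => exact (brauerNode_fold i).er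
  case ee_short h => exact foldE_mul_self_short h
  case ee_long h => exact foldE_mul_self_long h
  case rr_comm h => exact (brauerCommute_fold h).rr
  case er_comm h => exact (brauerCommute_fold h).er
  case ee_comm h => exact (brauerCommute_fold h).ee
  case braid h => exact (brauerBond_fold h).braid
  case rre h => exact (brauerBond_fold h).rre
  case rer h => exact (brauerBond_fold h).rer
  case db1 => exact BrauerPath.braid (A := BrE6) brauerPath_gen
  case db2 => exact BrauerPath.rre (A := BrE6) brauerPath_gen
  case db3 => exact BrauerPath.rere (A := BrE6) brauerPath_gen
  case db4 => exact BrauerPath.rrre (A := BrE6) brauerPath_gen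
  case db5 => exact (BrauerPath.ere (A := BrE6) brauerPath_gen).trans hδ
  case db6 => exact (BrauerPath.eee (A := BrE6) brauerPath_gen).trans hδ
  case db7 => exact BrauerPath.err (A := BrE6) brauerPath_gen
  case db8 => exact BrauerPath.eer (A := BrE6) brauerPath_gen

/-- The homomorphism `BrF4 → BrE6` folding the `E₆` diagram onto the `F₄` diagram. -/
noncomputable def fold : BrF4 →ₐ[Rring] BrE6 :=
  RingQuot.liftAlgHom Rring ⟨foldFree, foldFree_rel⟩

theorem fold_rgen (i : Fin 4) : fold (rgen i) = foldR i :=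
  (RingQuot.liftAlgHom_mkAlgHom_apply ..).trans (foldFree_R i)

theorem fold_egen (i : Fin 4) : fold (egen i) = foldE i :=
  (RingQuot.liftAlgHom_mkAlgHom_apply ..).trans (foldFree_E i)

/-- There is a `ℤ[δ,δ⁻¹]`-algebra homomorphism `φ : Br(F₄) → Br(E₆)` with
`φ(r₁) = R₁R₆`, `φ(r₂) = R₃R₅`, `φ(r₃) = R₄`, `φ(r₄) = R₂`,
`φ(e₁) = E₁E₆`, `φ(e₂) = E₃E₅`, `φ(e₃) = E₄`, `φ(e₄) = E₂`
(here stated with 0-based labels). -/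
theorem brF4_to_brE6_hom :
    ∃ φ : BrF4 →ₐ[Rring] BrE6,
      φ (rgen 0) = Rgen 0 * Rgen 5 ∧ φ (rgen 1) = Rgen 2 * Rgen 4 ∧
      φ (rgen 2) = Rgen 3 ∧ φ (rgen 3) = Rgen 1 ∧
      φ (egen 0) = Egen 0 * Egen 5 ∧ φ (egen 1) = Egen 2 * Egen 4 ∧
      φ (egen 2) = Egen 3 ∧ φ (egen 3) = Egen 1 := by
  exact ⟨fold, fold_rgen 0, fold_rgen 1, fold_rgen 2, fold_rgen 3,
    fold_egen 0, fold_egen 1, fold_egen 2, fold_egen 3⟩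
end

section
/- Let B be the unital associative ℤ[δ,δ⁻¹]-algebra with generators x_1,x_2,x_3,f_1,f_2,f_3 subject to precisely those defining relations of Br(F4) that involve only the indices 1, 2, 3 (with x_i in place of r_i and f_i in place of e_i); this algebra is isomorphic to the Brauer algebra Br(C3) of type C3. Then the canonical ℤ[δ,δ⁻¹]-algebra homomorphism B → Br(F4) sending x_i ↦ r_i and f_i ↦ e_i (i = 1,2,3) is injective. -/
open LaurentPolynomial

/-- Generators `x i`, `f i` (`i = 0,1,2`, i.e. 1-based `1,2,3`) of the subalgebra of type C₃. -/
inductive GenC3 : Type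
  | x : Fin 3 → GenC3
  | f : Fin 3 → GenC3

namespace BrC3rel

noncomputable abbrev X (i : Fin 3) : FreeAlgebra Rring GenC3 := FreeAlgebra.ι Rring (GenC3.x i)
noncomputable abbrev F (i : Fin 3) : FreeAlgebra Rring GenC3 := FreeAlgebra.ι Rring (GenC3.f i)

/-- Precisely the defining relations of `Br(F₄)` involving only the (1-based) indices `1,2,3`,
with `x_i` in place of `r_i` and `f_i` in place of `e_i` (0-based labels here). -/
inductive rel : FreeAlgebra Rring GenC3 → FreeAlgebra Rring GenC3 → Prop
  | xx (i : Fin 3) : rel (X i * X i) 1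
  | xf (i : Fin 3) : rel (X i * F i) (F i)
  | fx (i : Fin 3) : rel (F i * X i) (F i)
  | ff_short : rel (F 2 * F 2) (δ • F 2)
  | ff_long0 : rel (F 0 * F 0) ((δ ^ 2) • F 0)
  | ff_long1 : rel (F 1 * F 1) ((δ ^ 2) • F 1)
  | nxx : rel (X 0 * X 2) (X 2 * X 0)
  | nfx : rel (F 0 * X 2) (X 2 * F 0)
  | nxf : rel (F 2 * X 0) (X 0 * F 2)
  | nff : rel (F 0 * F 2) (F 2 * F 0)
  | braid : rel (X 0 * X 1 * X 0) (X 1 * X 0 * X 1)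
  | rre01 : rel (X 1 * X 0 * F 1) (F 0 * F 1)
  | rre10 : rel (X 0 * X 1 * F 0) (F 1 * F 0)
  | rer01 : rel (X 0 * F 1 * X 0) (X 1 * F 0 * X 1)
  | db1 : rel (X 1 * X 2 * X 1 * X 2) (X 2 * X 1 * X 2 * X 1)
  | db2 : rel (X 1 * X 2 * F 1) (X 2 * F 1)
  | db3 : rel (X 1 * F 2 * X 1 * F 2) (F 2 * F 1 * F 2)
  | db4 : rel (X 1 * X 2 * X 1 * F 2) (F 2 * (X 1 * X 2 * X 1))
  | db5 : rel (F 1 * X 2 * F 1) (δ • F 1)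
  | db6 : rel (F 1 * F 2 * F 1) (δ • F 1)
  | db7 : rel (F 1 * X 2 * X 1) (F 1 * X 2)
  | db8 : rel (F 1 * F 2 * X 1) (F 1 * F 2)

end BrC3rel

/-- The algebra `B` presented by the relations of `Br(F₄)` involving only indices `1,2,3`;
it is isomorphic to the Brauer algebra of type C₃. -/
noncomputable abbrev BrC3 : Type := RingQuot BrC3rel.rel

noncomputable def xgen (i : Fin 3) : BrC3 := RingQuot.mkAlgHom Rring BrC3rel.rel (BrC3rel.X i)
noncomputable def fgen (i : Fin 3) : BrC3 := RingQuot.mkAlgHom Rring BrC3rel.rel (BrC3rel.F i)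

/-! ### Words and rewriting rules -/

/-- The rewriting rule replacing the word `lhs` by `δ ^ exp • rhs`. -/
structure Rule where
  lhs : List ℕ
  rhs : List ℕ
  exp : ℕ
  deriving DecidableEq

/-- A rule obtained from an overlap: multiply both sides of the rule at position `source`
by the word `context` on the right and rewrite them. -/
structure Step where
  rule : Rule
  source : ℕ
  context : List ℕ

/-- `dropPrefix u w` is `some v` if `w = u ++ v`. The recursors are used directly here and below
to keep kernel evaluation cheap. -/
def dropPrefix (u : List ℕ) : List ℕ → Option (List ℕ) :=
  List.rec some (fun a _ ih w ↦
    List.rec none (fun b v _ ↦ bif Nat.beq a b then ih v else none) w) u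

/-- The first rule in `S` whose left-hand side is a prefix of `w`, with the rest of `w`. -/
def findRule (S : List Rule) (w : List ℕ) : Option (Rule × List ℕ) :=
  List.rec none (fun r _ ih ↦ Option.rec ih (fun v ↦ some (r, v)) (dropPrefix r.lhs w)) S

/-- Rewrite `todo.reverse ++ w`, where `S a` lists the rules to be tried on words starting
with `a`, and record the exponent of `δ`. The first argument bounds the number of steps. -/
def rewriteWord (S : ℕ → List Rule) : ℕ → List ℕ → List ℕ → ℕ × List ℕ
  | 0, todo, w => (0, todo.reverse ++ w)
  | _ + 1, [], w => (0, w)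
  | n + 1, a :: todo, w => match findRule (S a) (a :: w) with
    | none => rewriteWord S n todo (a :: w)
    | some (r, v) =>
      let p := rewriteWord S n (r.rhs.reverse ++ todo) v
      (r.exp + p.1, p.2)

def eqWord (u : List ℕ) : List ℕ → Bool :=
  List.rec (List.rec true fun _ _ _ ↦ false)
    (fun a _ ih w ↦ List.rec false (fun b v _ ↦ bif Nat.beq a b then ih v else false) w) u

def memWord (v : List ℕ) (l : List (List ℕ)) : Bool :=
  List.rec false (fun u _ ih ↦ bif eqWord u v then true else ih) l

/-- `forceWord v k = k v`, but the kernel evaluates `v` before `k v`. -/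
def forceWord {β : Type} (v : List ℕ) : (List ℕ → β) → β :=
  List.rec (fun k ↦ k []) (fun a _ ih k ↦ ih fun w ↦ k (a :: w)) v

/-- The rule `t` follows from the equality of `δ ^ p.1 • p.2` and `δ ^ q.1 • q.2`. -/
def Rule.joins (t : Rule) (p q : ℕ × List ℕ) : Bool :=
  eqWord p.2 t.lhs && eqWord q.2 t.rhs && Nat.beq (p.1 + t.exp) q.1

def Step.valid (S : List Rule) (s : Step) : Bool :=
  match S[s.source]? with
  | none => false
  | some r =>
    let p := rewriteWord (fun _ ↦ S) 100 (r.lhs ++ s.context).reverse []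
    let q := rewriteWord (fun _ ↦ S) 100 (r.rhs ++ s.context).reverse []
    s.rule.joins p (r.exp + q.1, q.2) || s.rule.joins (r.exp + q.1, q.2) p

def derivationValid : List Rule → List Step → Bool
  | _, [] => true
  | S, s :: l => s.valid S && derivationValid (s.rule :: S) l

/-- The words of length less than `n` beyond those of `l` that are irreducible for `S`. -/
def irreducibleWords (S : ℕ → List Rule) : ℕ → List (List ℕ) → List (List ℕ)
  | 0, _ => []
  | n + 1, l => l ++ irreducibleWords S n (l.flatMap fun w ↦
      ((List.range 6).filter fun a ↦ (findRule (S a) (a :: w)).isNone).map (· :: w))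

theorem dropPrefix_eq_some {u w v : List ℕ} (h : dropPrefix u w = some v) : w = u ++ v := by
  induction u generalizing w with
  | nil => exact Option.some.inj h
  | cons a u ih =>
    cases w with
    | nil => cases h
    | cons b w =>
      change (bif Nat.beq a b then dropPrefix u w else none) = some v at h
      cases hab : Nat.beq a b with
      | false => simp [hab] at h
      | true =>
        rw [hab] at h
        rw [Nat.eq_of_beq_eq_true hab, ih h, List.cons_append]

theorem findRule_eq_some {S : List Rule} {w : List ℕ} {p : Rule × List ℕ}
    (h : findRule S w = some p) : p.1 ∈ S ∧ w = p.1.lhs ++ p.2 := by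
  induction S with
  | nil => cases h
  | cons r S ih =>
    change Option.rec (findRule S w) (fun v ↦ some (r, v)) (dropPrefix r.lhs w) = some p at h
    cases hr : dropPrefix r.lhs w with
    | none =>
      rw [hr] at h
      exact ⟨List.mem_cons_of_mem _ (ih h).1, (ih h).2⟩
    | some v =>
      rw [hr] at h
      obtain rfl := Option.some.inj h
      exact ⟨List.mem_cons_self, dropPrefix_eq_some hr⟩

theorem eq_of_eqWord {u v : List ℕ} (h : eqWord u v = true) : u = v := by
  induction u generalizing v with
  | nil => cases v with
    | nil => rfl
    | cons => cases h
  | cons a u ih =>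
    cases v with
    | nil => cases h
    | cons b v =>
      change (bif Nat.beq a b then eqWord u v else false) = true at h
      cases hab : Nat.beq a b with
      | false => simp [hab] at h
      | true =>
        rw [hab] at h
        rw [Nat.eq_of_beq_eq_true hab, ih h]

theorem mem_of_memWord {v : List ℕ} {l : List (List ℕ)} (h : memWord v l = true) : v ∈ l := by
  induction l with
  | nil => cases h
  | cons u l ih =>
    change (bif eqWord u v then true else memWord v l) = true at h
    cases huv : eqWord u v with
    | false =>
      rw [huv] at h
      exact List.mem_cons_of_mem _ (ih h)
    | true => exact eq_of_eqWord huv ▸ List.mem_cons_self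

theorem forceWord_eq {β : Type} (v : List ℕ) (k : List ℕ → β) : forceWord v k = k v := by
  induction v generalizing k with
  | nil => rfl
  | cons a v ih => exact ih _

section Evaluation

variable {A : Type*} [Ring A] (g : ℕ → A)

/-- The product of the values of the letters of a word. -/
def wordProd (w : List ℕ) : A := (w.map g).prod

@[simp] theorem wordProd_nil : wordProd g [] = 1 := rfl

@[simp] theorem wordProd_cons (a : ℕ) (w : List ℕ) :
    wordProd g (a :: w) = g a * wordProd g w := by
  simp [wordProd]

@[simp] theorem wordProd_append (u v : List ℕ) :
    wordProd g (u ++ v) = wordProd g u * wordProd g v := by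
  simp [wordProd]

variable [Algebra Rring A]

/-- Both sides of the rule have the same value. -/
def Rule.Holds (r : Rule) : Prop := wordProd g r.lhs = δ ^ r.exp • wordProd g r.rhs

theorem wordProd_rewriteWord {S : ℕ → List Rule} (hS : ∀ a, ∀ r ∈ S a, r.Holds g) (n : ℕ)
    (todo w : List ℕ) :
    wordProd g (todo.reverse ++ w) =
      δ ^ (rewriteWord S n todo w).1 • wordProd g (rewriteWord S n todo w).2 := by
  induction n generalizing todo w with
  | zero => simp [rewriteWord]
  | succ n ih =>
    cases todo with
    | nil => simp [rewriteWord]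
    | cons a todo =>
      rw [rewriteWord]
      split
      next h => rw [← ih]; simp
      next r v h =>
        obtain ⟨hr, hw⟩ := findRule_eq_some h
        have hr' := hS a r hr
        have hs := ih (r.rhs.reverse ++ todo) v
        simp only at hw hs ⊢
        rw [pow_add, mul_smul, ← hs, List.reverse_cons, List.append_assoc, List.singleton_append,
          hw]
        simp only [wordProd_append, List.reverse_append, List.reverse_reverse, mul_assoc]
        rw [hr', smul_mul_assoc, mul_smul_comm]

theorem isUnit_δ : IsUnit δ := LaurentPolynomial.isUnit_T 1

theorem Rule.holds_of_joins {t : Rule} {p q : ℕ × List ℕ} (h : t.joins p q = true)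
    (hpq : δ ^ p.1 • wordProd g p.2 = δ ^ q.1 • wordProd g q.2) : t.Holds g := by
  simp only [Rule.joins, Bool.and_eq_true] at h
  obtain ⟨⟨hp, hq⟩, he⟩ := h
  rw [eq_of_eqWord hp, eq_of_eqWord hq, ← Nat.eq_of_beq_eq_true he, pow_add, mul_smul] at hpq
  exact (isUnit_δ.pow p.1).smul_left_cancel.mp hpq

theorem Step.rule_holds {S : List Rule} (hS : ∀ r ∈ S, r.Holds g) {s : Step}
    (h : s.valid S = true) : s.rule.Holds g := by
  unfold Step.valid at h
  split at h
  · cases h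
  next r hr =>
    have hr' := hS r (List.mem_of_getElem? hr)
    have hp := wordProd_rewriteWord g (fun _ ↦ hS) 100 (r.lhs ++ s.context).reverse []
    have hq := wordProd_rewriteWord g (fun _ ↦ hS) 100 (r.rhs ++ s.context).reverse []
    simp only [List.reverse_reverse, List.append_nil, wordProd_append] at hp hq
    rw [hr', smul_mul_assoc, hq, ← mul_smul, ← pow_add] at hp
    rcases Bool.or_eq_true_iff.mp h with h | h
    · exact Rule.holds_of_joins g h hp.symm
    · exact Rule.holds_of_joins g h hp

theorem holds_of_derivationValid {S : List Rule} (hS : ∀ r ∈ S, r.Holds g) {l : List Step}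
    (h : derivationValid S l = true) : ∀ r ∈ (l.map Step.rule).reverse ++ S, r.Holds g := by
  induction l generalizing S with
  | nil => simpa using hS
  | cons s l ih =>
    obtain ⟨hs, hl⟩ := Bool.and_eq_true_iff.mp h
    have := ih (S := s.rule :: S) (by simpa using ⟨Step.rule_holds g hS hs, hS⟩) hl
    simpa using this

end Evaluation

/-! ### A spanning set of `BrC3` -/

/-- The letters `0, 1, 2` stand for `x 0, x 1, x 2` and `3, 4, 5` for `f 0, f 1, f 2`. -/
noncomputable def c3Letter : ℕ → BrC3
  | 0 => xgen 0
  | 1 => xgen 1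
  | 2 => xgen 2
  | 3 => fgen 0
  | 4 => fgen 1
  | _ => fgen 2

/-- The defining relations of `BrC3`. -/
def c3Relations : List Rule :=
  [⟨[0, 0], [], 0⟩, ⟨[0, 3], [3], 0⟩, ⟨[3, 0], [3], 0⟩, ⟨[1, 1], [], 0⟩,
   ⟨[1, 4], [4], 0⟩, ⟨[4, 1], [4], 0⟩, ⟨[2, 2], [], 0⟩, ⟨[2, 5], [5], 0⟩,
   ⟨[5, 2], [5], 0⟩, ⟨[5, 5], [5], 1⟩, ⟨[3, 3], [3], 2⟩, ⟨[4, 4], [4], 2⟩,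
   ⟨[0, 2], [2, 0], 0⟩, ⟨[3, 2], [2, 3], 0⟩, ⟨[0, 5], [5, 0], 0⟩, ⟨[3, 5], [5, 3], 0⟩,
   ⟨[0, 1, 0], [1, 0, 1], 0⟩, ⟨[1, 0, 4], [3, 4], 0⟩, ⟨[0, 1, 3], [4, 3], 0⟩, ⟨[0, 4, 0], [1, 3, 1], 0⟩,
   ⟨[1, 2, 4], [2, 4], 0⟩, ⟨[4, 2, 4], [4], 1⟩, ⟨[4, 5, 4], [4], 1⟩, ⟨[4, 2, 1], [4, 2], 0⟩,
   ⟨[4, 5, 1], [4, 5], 0⟩, ⟨[1, 2, 1, 2], [2, 1, 2, 1], 0⟩, ⟨[1, 5, 1, 5], [5, 4, 5], 0⟩, ⟨[1, 2, 1, 5], [5, 1, 2, 1], 0⟩]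

/-- A completion of `c3Relations`. -/
def c3Derivation : List Step :=
  [⟨⟨[0, 1, 5, 0], [1, 0, 1, 5], 0⟩, 16, [5]⟩, ⟨⟨[0, 1, 2, 0], [1, 0, 1, 2], 0⟩, 17, [2]⟩,
   ⟨⟨[1, 3, 4], [0, 4], 0⟩, 5, [0, 4]⟩, ⟨⟨[4, 0, 4], [4, 3, 4], 0⟩, 8, [0, 4]⟩,
   ⟨⟨[0, 4, 3], [1, 3], 0⟩, 4, [1, 3]⟩, ⟨⟨[0, 1, 5, 3], [4, 5, 3], 0⟩, 23, [5]⟩,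
   ⟨⟨[0, 1, 2, 3], [4, 2, 3], 0⟩, 24, [2]⟩, ⟨⟨[3, 1, 3], [3, 4, 3], 0⟩, 9, [1, 3]⟩,
   ⟨⟨[0, 4, 5, 0], [1, 3, 1, 5], 0⟩, 27, [5]⟩, ⟨⟨[0, 4, 2, 0], [1, 3, 1, 2], 0⟩, 28, [2]⟩,
   ⟨⟨[4, 3, 1], [4, 0], 0⟩, 10, [4, 0]⟩, ⟨⟨[3, 4, 0], [3, 1], 0⟩, 28, [0]⟩,
   ⟨⟨[4, 3, 4], [4], 0⟩, 30, [4]⟩, ⟨⟨[3, 4, 3], [3], 0⟩, 30, [3]⟩,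
   ⟨⟨[0, 4, 5, 3], [1, 5, 3], 0⟩, 9, [5]⟩, ⟨⟨[0, 4, 2, 3], [1, 2, 3], 0⟩, 10, [2]⟩,
   ⟨⟨[3, 1, 5, 3], [3, 4, 5, 3], 0⟩, 8, [5]⟩, ⟨⟨[3, 1, 2, 3], [3, 4, 2, 3], 0⟩, 9, [2]⟩,
   ⟨⟨[4, 0, 1], [4, 3], 0⟩, 7, [1]⟩, ⟨⟨[3, 4, 5, 0], [3, 1, 5], 0⟩, 7, [5]⟩,
   ⟨⟨[3, 4, 2, 0], [3, 1, 2], 0⟩, 8, [2]⟩, ⟨⟨[3, 1, 0], [3, 4], 0⟩, 9, [0]⟩,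
   ⟨⟨[3, 4, 5, 3], [5, 3], 0⟩, 8, [5]⟩, ⟨⟨[3, 4, 2, 3], [2, 3], 0⟩, 9, [2]⟩,
   ⟨⟨[3, 1, 5, 0], [3, 4, 5], 0⟩, 2, [5]⟩, ⟨⟨[3, 1, 2, 0], [3, 4, 2], 0⟩, 3, [2]⟩,
   ⟨⟨[4, 2, 0, 4], [4, 2, 3, 4], 0⟩, 49, [0, 4]⟩, ⟨⟨[4, 5, 0, 4], [4, 5, 3, 4], 0⟩, 51, [0, 4]⟩,
   ⟨⟨[1, 5, 4, 5], [5, 1, 5], 0⟩, 31, [5, 1, 5]⟩, ⟨⟨[1, 5, 1, 2, 1], [2, 1, 5], 0⟩, 32, [2, 1, 5]⟩,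
   ⟨⟨[3, 1, 5, 4], [5, 3, 4], 0⟩, 10, [4]⟩, ⟨⟨[5, 1, 5, 1], [5, 1, 5], 0⟩, 2, [1]⟩,
   ⟨⟨[5, 1, 5, 4], [1, 5, 4], 1⟩, 3, [4]⟩, ⟨⟨[5, 3, 1, 5], [5, 3, 4, 5], 0⟩, 2, [5]⟩,
   ⟨⟨[5, 1, 5], [5, 4, 5], 0⟩, 2, [5]⟩, ⟨⟨[1, 5, 4], [5, 4], 0⟩, 2, []⟩,
   ⟨⟨[5, 0, 1, 5], [5, 0, 4, 5], 0⟩, 50, [1, 5]⟩, ⟨⟨[5, 1, 0, 1, 5], [5, 1, 3, 1, 5], 0⟩, 0, [0]⟩,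
   ⟨⟨[0, 1, 5, 1, 0, 1], [1, 0, 1, 5, 1, 0], 0⟩, 37, [1, 0]⟩, ⟨⟨[0, 1, 2, 1, 0, 1], [1, 0, 1, 2, 1, 0], 0⟩, 37, [1, 0]⟩,
   ⟨⟨[0, 1, 2, 1, 3], [1, 2, 1, 3], 0⟩, 38, [4, 3]⟩, ⟨⟨[0, 1, 5, 1, 3], [1, 5, 1, 3], 0⟩, 40, [4, 3]⟩,
   ⟨⟨[4, 5, 3, 1, 2, 1], [4, 2, 0, 1, 5], 0⟩, 31, [2, 1, 5]⟩, ⟨⟨[4, 2, 3, 1, 2, 1], [4, 2, 0, 1, 2], 0⟩, 32, [2, 1, 2]⟩,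
   ⟨⟨[4, 5, 0, 1, 2, 1], [4, 2, 3, 1, 5], 0⟩, 25, [2, 1, 5]⟩, ⟨⟨[4, 2, 0, 1, 2, 1], [4, 2, 3, 1, 2], 0⟩, 26, [2, 1, 2]⟩,
   ⟨⟨[3, 1, 5, 1, 3], [3], 1⟩, 26, [1, 3]⟩, ⟨⟨[3, 1, 5, 1, 0], [3, 1, 5, 1], 0⟩, 27, [1, 0]⟩,
   ⟨⟨[3, 1, 2, 1, 3], [3], 1⟩, 27, [1, 3]⟩, ⟨⟨[3, 1, 2, 1, 0], [3, 1, 2, 1], 0⟩, 28, [1, 0]⟩,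
   ⟨⟨[1, 5, 1, 2], [2, 1, 5, 1], 0⟩, 20, [1]⟩, ⟨⟨[4, 2, 0, 1, 5, 1], [4, 5, 3, 1, 2], 0⟩, 32, [5, 1, 2]⟩,
   ⟨⟨[4, 2, 3, 1, 5, 1], [4, 5, 0, 1, 2], 0⟩, 41, [5, 1, 2]⟩, ⟨⟨[5, 1, 2, 1, 3, 1, 5], [5, 1, 2, 0, 4, 5], 0⟩, 80, [3, 1, 5]⟩,
   ⟨⟨[5, 1, 2, 1, 0, 1, 5], [5, 1, 2, 3, 4, 5], 0⟩, 81, [0, 1, 5]⟩, ⟨⟨[5, 1, 2, 0, 1, 5], [5, 1, 2, 3, 1, 5], 0⟩, 17, [1, 2, 1]⟩]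

def c3Rules : List Rule := (c3Derivation.map Step.rule).reverse ++ c3Relations

def c3RulesFrom (a : ℕ) : List Rule :=
  c3Rules.filter fun r ↦ List.rec false (fun b _ _ ↦ Nat.beq b a) r.lhs

/-- The irreducible words, which label a basis of `BrC3`. -/
def c3Basis : List (List ℕ) := irreducibleWords c3RulesFrom 11 [[]]

theorem derivationValid_c3 : derivationValid c3Relations c3Derivation = true := by
  decide +kernel

theorem nil_mem_c3Basis : [] ∈ c3Basis := List.mem_append_left _ (List.mem_singleton_self _)

theorem memWord_rewriteWord_c3Basis :
    (c3Basis.all fun w ↦ (List.range 6).all fun a ↦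
      forceWord (rewriteWord c3RulesFrom 100 [a] w).2 fun v ↦ memWord v c3Basis) = true := by
  decide +kernel

theorem c3Relations_holds : ∀ r ∈ c3Relations, r.Holds c3Letter := by
  have key {a b : FreeAlgebra Rring GenC3} (h : BrC3rel.rel a b) :=
    RingQuot.mkAlgHom_rel Rring h
  simp only [c3Relations, List.forall_mem_cons, Rule.Holds, wordProd_cons, wordProd_nil, mul_one,
    c3Letter, xgen, fgen, ← map_mul, pow_zero, one_smul, pow_one, ← map_smul, ← mul_assoc]
  refine ⟨key (.xx 0) |>.trans (map_one _), key (.xf 0), key (.fx 0),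
    key (.xx 1) |>.trans (map_one _), key (.xf 1), key (.fx 1),
    key (.xx 2) |>.trans (map_one _), key (.xf 2), key (.fx 2), key .ff_short, key .ff_long0,
    key .ff_long1, key .nxx, key .nfx, (key .nxf).symm, key .nff, key .braid, key .rre01, key .rre10, key .rer01, key .db2,
    key .db5, key .db6, key .db7, key .db8, key .db1, key .db3, ?_, by simp⟩
  simpa only [mul_assoc] using key .db4

theorem span_c3Basis :
    Submodule.span Rring (wordProd c3Letter '' {w | w ∈ c3Basis}) = ⊤ := by
  set M := Submodule.span Rring (wordProd c3Letter '' {w | w ∈ c3Basis})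
  have hrules (a : ℕ) : ∀ r ∈ c3RulesFrom a, r.Holds c3Letter := fun r hr ↦
    holds_of_derivationValid _ c3Relations_holds derivationValid_c3 r (List.mem_of_mem_filter hr)
  have hmul (a : ℕ) (ha : a < 6) : ∀ b ∈ M, c3Letter a * b ∈ M := by
    intro b hb
    induction hb using Submodule.span_induction with
    | mem _ h =>
      obtain ⟨w, hw, rfl⟩ := h
      have hmem := List.all_eq_true.mp (List.all_eq_true.mp memWord_rewriteWord_c3Basis w hw) a
        (List.mem_range.mpr ha)
      rw [forceWord_eq] at hmem
      have hrw := wordProd_rewriteWord c3Letter hrules 100 [a] w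
      rw [List.reverse_singleton, List.singleton_append, wordProd_cons] at hrw
      rw [hrw]
      exact M.smul_mem _ (Submodule.subset_span ⟨_, mem_of_memWord hmem, rfl⟩)
    | zero => simp
    | add _ _ _ _ h₁ h₂ => rw [mul_add]; exact M.add_mem h₁ h₂
    | smul c _ _ h => rw [mul_smul_comm]; exact M.smul_mem c h
  have hgen (s : GenC3) :
      ∃ a < 6, c3Letter a = RingQuot.mkAlgHom Rring BrC3rel.rel (FreeAlgebra.ι Rring s) := by
    cases s with
    | x i =>
      fin_cases i
      exacts [⟨0, by decide, rfl⟩, ⟨1, by decide, rfl⟩, ⟨2, by decide, rfl⟩]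
    | f i =>
      fin_cases i
      exacts [⟨3, by decide, rfl⟩, ⟨4, by decide, rfl⟩, ⟨5, by decide, rfl⟩]
  have hall (z : FreeAlgebra Rring GenC3) :
      ∀ b ∈ M, RingQuot.mkAlgHom Rring BrC3rel.rel z * b ∈ M := by
    induction z using FreeAlgebra.induction with
    | grade0 r => intro b hb; rw [AlgHom.commutes, ← Algebra.smul_def]; exact M.smul_mem r hb
    | grade1 s => obtain ⟨a, ha, h⟩ := hgen s; exact h ▸ hmul a ha
    | mul y z hy hz => intro b hb; rw [map_mul, mul_assoc]; exact hy _ (hz b hb)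
    | add y z hy hz => intro b hb; rw [map_add, add_mul]; exact M.add_mem (hy b hb) (hz b hb)
  refine eq_top_iff.mpr fun b _ ↦ ?_
  obtain ⟨z, rfl⟩ := RingQuot.mkAlgHom_surjective Rring BrC3rel.rel b
  simpa using hall z 1 (Submodule.subset_span ⟨[], nil_mem_c3Basis, rfl⟩)

/-! ### Operators from weighted partial maps -/

/-- A partial map on `Ω`, with a power of `δ` attached to each point of its domain. -/
abbrev WeightedMap (Ω : Type*) : Type _ := Ω → Option (ℕ × Ω)

namespace WeightedMap

variable {Ω : Type*}

def comp (f g : WeightedMap Ω) : WeightedMap Ω := fun x ↦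
  (g x).bind fun p ↦ (f p.2).map fun q ↦ (p.1 + q.1, q.2)

def word (a : ℕ → WeightedMap Ω) : List ℕ → WeightedMap Ω
  | [] => fun x ↦ some (0, x)
  | g :: w => comp (a g) (word a w)

/-- The product of two weighted partial maps, with the weights of the first one. -/
def pair (f g : WeightedMap Ω) : WeightedMap (Ω × Ω) := fun z ↦
  (f z.1).bind fun p ↦ (g z.2).map fun q ↦ (p.1, p.2, q.2)

/-- The restriction of a weighted partial map to an invariant set. -/
def restrict {P : Ω → Prop} (f : WeightedMap Ω) (h : ∀ x, P x → ∀ p, f x = some p → P p.2) :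
    WeightedMap {x // P x} := fun x ↦
  (f x).pmap (fun p hp ↦ (p.1, ⟨p.2, hp⟩)) (h x x.2)

/-- The rule `r` holds for the action `a` at the point `x`. -/
def RespectsAt (a : ℕ → WeightedMap Ω) (r : Rule) (x : Ω) : Prop :=
  word a r.lhs x = (word a r.rhs x).map fun p ↦ (r.exp + p.1, p.2)

theorem pair_comp (f f' g g' : WeightedMap Ω) :
    pair (comp f f') (comp g g') = comp (pair f g) (pair f' g') := by
  funext ⟨x, y⟩
  simp only [pair, comp]
  cases f' x with
  | none => rfl
  | some p =>
    cases g' y with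
    | none => cases hf : f p.2 <;> simp [hf]
    | some q => cases hf : f p.2 <;> cases hg : g q.2 <;> simp [hf, hg]

theorem word_pair (a b : ℕ → WeightedMap Ω) (w : List ℕ) :
    word (fun i ↦ pair (a i) (b i)) w = pair (word a w) (word b w) := by
  induction w with
  | nil => rfl
  | cons i w ih => rw [word, ih, word, word, pair_comp]

theorem map_restrict {P : Ω → Prop} (f : WeightedMap Ω)
    (h : ∀ x, P x → ∀ p, f x = some p → P p.2) (x : {x // P x}) :
    (restrict f h x).map (fun p ↦ (p.1, p.2.1)) = f x := by
  simp [restrict, Option.map_pmap]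

theorem map_word_restrict {P : Ω → Prop} (a : ℕ → WeightedMap Ω)
    (h : ∀ i, ∀ x, P x → ∀ p, a i x = some p → P p.2) (w : List ℕ) (x : {x // P x}) :
    (word (fun i ↦ restrict (a i) (h i)) w x).map (fun p ↦ (p.1, p.2.1)) = word a w x := by
  induction w with
  | nil => rfl
  | cons i w ih =>
    simp only [word, comp]
    rw [← ih]
    cases word (fun i ↦ restrict (a i) (h i)) w x with
    | none => rfl
    | some p =>
      simp only [Option.bind_some, Option.map_some, Option.map_map]
      rw [← map_restrict (a i) (h i) p.2, Option.map_map]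
      rfl

theorem RespectsAt.restrict {P : Ω → Prop} {a : ℕ → WeightedMap Ω}
    (h : ∀ i, ∀ x, P x → ∀ p, a i x = some p → P p.2) {r : Rule} {x : {x // P x}}
    (hr : RespectsAt a r x) : RespectsAt (fun i ↦ restrict (a i) (h i)) r x := by
  have hinj : Function.Injective fun p : ℕ × {x // P x} ↦ (p.1, p.2.1) := fun p q hpq ↦ by
    simp only [Prod.mk.injEq] at hpq
    exact Prod.ext hpq.1 (Subtype.ext hpq.2)
  apply Option.map_injective hinj
  rw [map_word_restrict, hr, ← map_word_restrict a h, Option.map_map, Option.map_map]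
  rfl

theorem RespectsAt.pair {a b : ℕ → WeightedMap Ω} {r : Rule} {z : Ω × Ω}
    (ha : RespectsAt a r z.1) (hb : RespectsAt b r z.2) :
    RespectsAt (fun i ↦ pair (a i) (b i)) r z := by
  unfold RespectsAt at *
  rw [word_pair, word_pair]
  simp only [WeightedMap.pair]
  rw [ha, hb]
  cases word a r.rhs z.1 <;> cases word b r.rhs z.2 <;> rfl

/-- The vector `δ ^ k • x` for `some (k, x)`, and `0` for `none`. -/
noncomputable def vec : Option (ℕ × Ω) → Ω →₀ Rring
  | none => 0
  | some p => Finsupp.single p.2 (δ ^ p.1)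

/-- The linear operator of a weighted partial map. -/
noncomputable def op (f : WeightedMap Ω) : Module.End Rring (Ω →₀ Rring) :=
  Finsupp.linearCombination Rring fun x ↦ vec (f x)

theorem op_single (f : WeightedMap Ω) (x : Ω) (c : Rring) :
    op f (Finsupp.single x c) = c • vec (f x) := by
  simp [op]

theorem op_comp (f g : WeightedMap Ω) : op (comp f g) = op f * op g := by
  refine Finsupp.lhom_ext fun x c ↦ ?_
  rw [Module.End.mul_apply, op_single, op_single, map_smul]
  congr 1
  cases hg : g x with
  | none => simp [comp, hg, vec]
  | some p => cases hf : f p.2 <;> simp [comp, hg, hf, vec, op_single, pow_add]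

theorem wordProd_op (a : ℕ → WeightedMap Ω) (w : List ℕ) :
    wordProd (fun i ↦ op (a i)) w = op (word a w) := by
  induction w with
  | nil =>
    refine Finsupp.lhom_ext fun x c ↦ ?_
    simp [word, op_single, vec]
  | cons i w ih => rw [wordProd_cons, ih, word, op_comp]

theorem holds_op {a : ℕ → WeightedMap Ω} {r : Rule} (h : ∀ x, RespectsAt a r x) :
    r.Holds fun i ↦ op (a i) := by
  unfold Rule.Holds
  rw [wordProd_op, wordProd_op]
  refine Finsupp.lhom_ext fun x c ↦ ?_
  rw [LinearMap.smul_apply, op_single, op_single, h x, smul_comm]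
  congr 1
  cases word a r.rhs x <;> simp [vec, pow_add]

end WeightedMap

/-! ### Linear independence from leading terms -/

theorem coeff_mul_δ_pow (c : Rring) (k : ℕ) (n : ℤ) :
    (c * δ ^ k).coeff n = c.coeff (n - k) := by
  rw [δ, LaurentPolynomial.T_pow, mul_one, LaurentPolynomial.T,
    AddMonoidAlgebra.coeff_mul_single_apply, mul_one, sub_eq_add_neg]

theorem eq_zero_of_leading_terms {ι : Type*} [Fintype ι] (c : ι → Rring)
    (h : ∀ j, ∃ (m : ℕ) (v : ι → Rring), v j = δ ^ m ∧
      (∀ i, i ≠ j → v i = 0 ∨ ∃ k < m, v i = δ ^ k) ∧ ∑ i, c i * v i = 0) :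
    ∀ i, c i = 0 := by
  classical
  by_contra! hc
  obtain ⟨i₀, hc⟩ := hc
  have hne : (Finset.univ.biUnion fun i ↦ (c i).coeff.support).Nonempty := by
    rw [Finset.biUnion_nonempty]
    refine ⟨i₀, Finset.mem_univ _, Finsupp.support_nonempty_iff.mpr fun h0 ↦ hc ?_⟩
    exact LaurentPolynomial.ext fun n ↦ by rw [h0]; rfl
  obtain ⟨j, -, hd⟩ := Finset.mem_biUnion.mp (Finset.max'_mem _ hne)
  set d := Finset.max' _ hne
  have hmax (i : ι) (n : ℤ) (hn : d < n) : (c i).coeff n = 0 := by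
    by_contra h0
    exact hn.not_ge (Finset.le_max' _ _
      (Finset.mem_biUnion.mpr ⟨i, Finset.mem_univ _, Finsupp.mem_support_iff.mpr h0⟩))
  obtain ⟨m, v, hvj, hv, hsum⟩ := h j
  have hcoeff := congr_arg (fun f : Rring ↦ f.coeff (d + m)) hsum
  simp only [AddMonoidAlgebra.coeff_sum, Finsupp.finsetSum_apply] at hcoeff
  rw [Finset.sum_eq_single_of_mem j (Finset.mem_univ _), hvj, coeff_mul_δ_pow, add_sub_cancel_right] at hcoeff
  · exact Finsupp.mem_support_iff.mp hd hcoeff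
  · intro i _ hij
    rcases hv i hij with h0 | ⟨k, hk, h0⟩
    · rw [h0, mul_zero]; rfl
    · rw [h0, coeff_mul_δ_pow]
      exact hmax i _ (by lia)

/-! ### The action of the generators on affine subspaces of `𝔽₂⁶`

The vectors of the root lattice of type E₆ modulo `2` are numbered by `0, …, 63`, the simple roots
being `2 ^ i` with `i < 6`, where `0, 1, 2, 3, 4` form a chain and `5` is joined to `2`. A subset
is encoded by the number whose binary digits form its indicator function. The generators of `BrF4`
act through the folding of E₆ that swaps `0` with `4` and `1` with `3`. -/

namespace E6

/-- The vectors whose `i`-th coordinate is `1`. -/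
def coord : ℕ → ℕ
  | 0 => 12297829382473034410
  | 1 => 14757395258967641292
  | 2 => 17361641481138401520
  | 3 => 18374966859414961920
  | 4 => 18446462603027742720
  | _ => 18446744069414584320

/-- The vectors that are not orthogonal to the `i`-th simple root. -/
def nonorthogonal : ℕ → ℕ
  | 0 => coord 1
  | 1 => coord 0 ^^^ coord 2
  | 2 => coord 1 ^^^ coord 3 ^^^ coord 5
  | 3 => coord 2 ^^^ coord 4
  | 4 => coord 3
  | _ => coord 2

/-- The translation by the `i`-th simple root. -/
def translate (i X : ℕ) : ℕ :=
  (X &&& coord i) >>> 2 ^ i ||| (X <<< 2 ^ i) &&& coord i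

/-- The transvection of the `i`-th simple root. -/
def reflect (i X : ℕ) : ℕ :=
  (X ^^^ (X &&& nonorthogonal i)) ||| translate i (X &&& nonorthogonal i)

/-- The vectors of `X` and of its translate that are orthogonal to the `i`-th simple root. -/
def contract (i X : ℕ) : ℕ :=
  (X ||| translate i X) ^^^ ((X ||| translate i X) &&& nonorthogonal i)

/-- `force n k = k n`, but the kernel evaluates `n` before `k n`. -/
def force {β : Type} (n : ℕ) (k : ℕ → β) : β := Nat.rec (k 0) (fun m _ ↦ k (Nat.succ m)) n

/-- The Temperley-Lieb generator of the `i`-th node. -/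
def cap (i : ℕ) : WeightedMap ℕ := fun X ↦
  bif Nat.beq (translate i X) X then some (1, X)
  else bif Nat.beq (X &&& nonorthogonal i) 0 || Nat.beq (X &&& nonorthogonal i) X then none
  else force (contract i X) fun Y ↦ some (0, Y)

/-- The letters `0, 1, 2, 3` stand for the generators `r` and `4, 5, 6, 7` for the `e`. -/
def act : ℕ → WeightedMap ℕ
  | 0 => fun X ↦ force (reflect 0 (reflect 4 X)) fun Y ↦ some (0, Y)
  | 1 => fun X ↦ force (reflect 1 (reflect 3 X)) fun Y ↦ some (0, Y)
  | 2 => fun X ↦ force (reflect 2 X) fun Y ↦ some (0, Y)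
  | 3 => fun X ↦ force (reflect 5 X) fun Y ↦ some (0, Y)
  | 4 => WeightedMap.comp (cap 0) (cap 4)
  | 5 => WeightedMap.comp (cap 1) (cap 3)
  | 6 => cap 2
  | _ => cap 5

def memNat (n : ℕ) (l : List ℕ) : Bool :=
  List.rec false (fun m _ ih ↦ bif Nat.beq m n then true else ih) l

def isStable (l : List ℕ) : Option (ℕ × ℕ) → Bool
  | none => true
  | some p => memNat p.2 l

/-- The points reached from `todo`, together with `seen`. -/
def orbit : ℕ → List ℕ → List ℕ → List ℕ
  | 0, _, seen => seen
  | _ + 1, [], seen => seen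
  | n + 1, X :: todo, seen => bif memNat X seen then orbit n todo seen else
      orbit n (((List.range 8).filterMap fun g ↦ (act g X).map Prod.snd) ++ todo) (X :: seen)

def coset (u : ℕ) (L : List ℕ) : ℕ := (L.map fun v ↦ 2 ^ (u ^^^ v)).sum

/-- The leading exponents of `δ`, the seeds, and the words applied to them, from which the
leading terms of the words in `c3Basis` are read off. -/
def seeds : List (ℕ × (ℕ × ℕ) × List (List ℕ)) :=
  [(0, (coset 1 [0], coset 42 [0]), [[]]),
   (1, (coset 1 [0, 4], coset 10 [0, 4]), [[], [1], [0, 1]]),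
   (2, (coset 32 [0, 2, 8, 10], coset 32 [0, 2, 8, 10]),
    [[], [0], [2], [3], [5], [2, 0], [5, 0], [1, 2, 0], [1, 5, 0]]),
   (3, (coset 0 [0, 1, 4, 5, 16, 17, 20, 21], coset 0 [0, 1, 4, 5, 16, 17, 20, 21]),
    [[], [1], [4], [2, 1], [5, 1], [2, 4], [1, 2, 1]])]

def points : List ℕ := orbit 3000 (seeds.flatMap fun s ↦ [s.2.1.1, s.2.1.2]) []

theorem isStable_act :
    (points.all fun X ↦ (List.range 8).all fun g ↦ isStable points (act g X)) = true := by
  decide +kernel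

def f4Relations : List Rule :=
  (List.range 4).flatMap (fun i ↦ [⟨[i, i], [], 0⟩, ⟨[i, i + 4], [i + 4], 0⟩,
    ⟨[i + 4, i], [i + 4], 0⟩, ⟨[i + 4, i + 4], [i + 4], if i < 2 then 2 else 1⟩]) ++
  [(0, 2), (2, 0), (0, 3), (3, 0), (1, 3), (3, 1)].flatMap (fun (i, j) ↦
    [⟨[i, j], [j, i], 0⟩, ⟨[i + 4, j], [j, i + 4], 0⟩, ⟨[i + 4, j + 4], [j + 4, i + 4], 0⟩]) ++
  [(0, 1), (1, 0), (2, 3), (3, 2)].flatMap (fun (i, j) ↦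
    [⟨[i, j, i], [j, i, j], 0⟩, ⟨[j, i, j + 4], [i + 4, j + 4], 0⟩,
      ⟨[i, j + 4, i], [j, i + 4, j], 0⟩]) ++
  [⟨[1, 2, 1, 2], [2, 1, 2, 1], 0⟩, ⟨[1, 2, 5], [2, 5], 0⟩, ⟨[1, 6, 1, 6], [6, 5, 6], 0⟩,
    ⟨[1, 2, 1, 6], [6, 1, 2, 1], 0⟩, ⟨[5, 2, 5], [5], 1⟩, ⟨[5, 6, 5], [5], 1⟩,
    ⟨[5, 2, 1], [5, 2], 0⟩, ⟨[5, 6, 1], [5, 6], 0⟩]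

def eqImage (k : ℕ) : Option (ℕ × ℕ) → Option (ℕ × ℕ) → Bool
  | none, none => true
  | some p, some q => Nat.beq p.1 (k + q.1) && Nat.beq p.2 q.2
  | _, _ => false

theorem eqImage_f4Relations :
    (points.all fun X ↦ f4Relations.all fun r ↦
      eqImage r.exp (WeightedMap.word act r.lhs X) (WeightedMap.word act r.rhs X)) = true := by
  decide +kernel

/-- The action of the letters of `BrC3`. -/
def c3Act : ℕ → WeightedMap ℕ
  | 0 => act 0
  | 1 => act 1
  | 2 => act 2
  | 3 => act 4
  | 4 => act 5
  | _ => act 6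

/-- The leading exponents of `δ` and the points from which leading terms are read off. -/
def probes : List (ℕ × ℕ × ℕ) := seeds.flatMap fun s ↦ s.2.2.filterMap fun w ↦
  (WeightedMap.word c3Act w s.2.1.1).bind fun p ↦
    (WeightedMap.word c3Act w s.2.1.2).map fun q ↦ (s.1, p.2, q.2)

/-- The image of `z` under a word in the letters of `BrC3`. -/
def image (w : List ℕ) (z : ℕ × ℕ) : Option (ℕ × ℕ × ℕ) :=
  WeightedMap.pair (WeightedMap.word c3Act w) (WeightedMap.word c3Act w) z

def expLE (m : ℕ) : Option (ℕ × ℕ × ℕ) → Bool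
  | none => true
  | some p => Nat.ble p.1 m

def expEq (m : ℕ) : Option (ℕ × ℕ × ℕ) → Bool
  | none => false
  | some p => Nat.beq p.1 m

def eqTarget : Option (ℕ × ℕ × ℕ) → Option (ℕ × ℕ × ℕ) → Bool
  | some p, some q => Nat.beq p.2.1 q.2.1 && Nat.beq p.2.2 q.2.2
  | _, _ => false

def distinct : List (Option (ℕ × ℕ × ℕ)) → Bool
  | [] => true
  | p :: l => (l.all fun q ↦ !eqTarget p q) && distinct l

theorem image_c3Basis :
    ((probes.all fun q ↦ memNat q.2.1 points && memNat q.2.2 points) &&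
      ((probes.all fun q ↦ (c3Basis.all fun w ↦ expLE q.1 (image w q.2)) &&
        distinct ((c3Basis.filter fun w ↦ expEq q.1 (image w q.2)).map fun w ↦ image w q.2)) &&
      c3Basis.all fun w ↦ probes.any fun q ↦ expEq q.1 (image w q.2))) = true := by
  decide +kernel

theorem mem_of_memNat {n : ℕ} {l : List ℕ} (h : memNat n l = true) : n ∈ l := by
  induction l with
  | nil => cases h
  | cons m l ih =>
    change (bif Nat.beq m n then true else memNat n l) = true at h
    cases hmn : Nat.beq m n with
    | false =>
      rw [hmn] at h
      exact List.mem_cons_of_mem _ (ih h)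
    | true => exact Nat.eq_of_beq_eq_true hmn ▸ List.mem_cons_self

theorem mem_points_of_act (g : ℕ) (X : ℕ) (hX : X ∈ points) (p : ℕ × ℕ)
    (hp : act g X = some p) : p.2 ∈ points := by
  have key (i : ℕ) (hi : i < 8) (hp : act i X = some p) : p.2 ∈ points := by
    have h := List.all_eq_true.mp (List.all_eq_true.mp isStable_act X hX) i (List.mem_range.mpr hi)
    rw [hp] at h
    exact mem_of_memNat h
  by_cases hg : g < 8
  · exact key g hg hp
  · obtain ⟨n, rfl⟩ := Nat.exists_eq_add_of_le' (not_lt.mp hg)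
    exact key 7 (by decide) hp

theorem respectsAt_act {r : Rule} (hr : r ∈ f4Relations) {X : ℕ} (hX : X ∈ points) :
    WeightedMap.RespectsAt act r X := by
  have h := List.all_eq_true.mp (List.all_eq_true.mp eqImage_f4Relations X hX) r hr
  unfold WeightedMap.RespectsAt
  cases hl : WeightedMap.word act r.lhs X <;> cases hr : WeightedMap.word act r.rhs X <;>
    rw [hl, hr] at h
  · rfl
  · cases h
  · cases h
  · obtain ⟨h₁, h₂⟩ := Bool.and_eq_true_iff.mp h
    exact congr_arg some (Prod.ext (Nat.eq_of_beq_eq_true h₁) (Nat.eq_of_beq_eq_true h₂))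

/-- The action on the orbit of the seeds. -/
def actPoints (g : ℕ) : WeightedMap {X // X ∈ points} :=
  WeightedMap.restrict (act g) (mem_points_of_act g)

/-- The diagonal action on pairs of points. -/
def actPairs (g : ℕ) : WeightedMap ({X // X ∈ points} × {X // X ∈ points}) :=
  WeightedMap.pair (actPoints g) (actPoints g)

theorem holds_op_actPairs {r : Rule} (hr : r ∈ f4Relations) :
    r.Holds fun g ↦ WeightedMap.op (actPairs g) :=
  WeightedMap.holds_op fun z ↦
    WeightedMap.RespectsAt.pair
      (WeightedMap.RespectsAt.restrict mem_points_of_act (respectsAt_act hr z.1.2))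
      (WeightedMap.RespectsAt.restrict mem_points_of_act (respectsAt_act hr z.2.2))

/-- The number of the letter of a generator of `BrF4`. -/
def f4Index : GenF4 → ℕ
  | .r i => i
  | .e i => i + 4

/-- The action of the free algebra on the span of the pairs of points. -/
noncomputable def freeRep : FreeAlgebra Rring GenF4 →ₐ[Rring]
    Module.End Rring (({X // X ∈ points} × {X // X ∈ points}) →₀ Rring) :=
  FreeAlgebra.lift Rring fun s ↦ WeightedMap.op (actPairs (f4Index s))

theorem freeRep_rel {a b : FreeAlgebra Rring GenF4} (h : BrF4rel.rel a b) :
    freeRep a = freeRep b := by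
  have key {r : Rule} (hr : r ∈ f4Relations) := holds_op_actPairs hr
  have hR (i : Fin 4) : freeRep (BrF4rel.R i) = WeightedMap.op (actPairs i) :=
    FreeAlgebra.lift_ι_apply _ _
  have hE (i : Fin 4) : freeRep (BrF4rel.E i) = WeightedMap.op (actPairs (i + 4)) :=
    FreeAlgebra.lift_ι_apply _ _
  simp only [Rule.Holds] at key
  cases h
  case rr i => simpa [hR] using key (r := ⟨[i, i], [], 0⟩) (by revert i; decide)
  case re i => simpa [hR, hE] using key (r := ⟨[i, i + 4], [i + 4], 0⟩) (by revert i; decide)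
  case er i => simpa [hR, hE] using key (r := ⟨[i + 4, i], [i + 4], 0⟩) (by revert i; decide)
  case ee_short i h =>
    simpa [hE] using key (r := ⟨[i + 4, i + 4], [i + 4], 1⟩) (by revert i; decide)
  case ee_long i h =>
    simpa [hE] using key (r := ⟨[i + 4, i + 4], [i + 4], 2⟩) (by revert i; decide)
  case rr_comm i j h =>
    simpa [hR] using key (r := ⟨[i, j], [j, i], 0⟩)
      (by unfold BrF4rel.nadj at h; revert i j; decide)
  case er_comm i j h =>
    simpa [hR, hE] using key (r := ⟨[i + 4, j], [j, i + 4], 0⟩)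
      (by unfold BrF4rel.nadj at h; revert i j; decide)
  case ee_comm i j h =>
    simpa [hE] using key (r := ⟨[i + 4, j + 4], [j + 4, i + 4], 0⟩)
      (by unfold BrF4rel.nadj at h; revert i j; decide)
  case braid i j h =>
    simpa [hR, mul_assoc] using key (r := ⟨[i, j, i], [j, i, j], 0⟩)
      (by unfold BrF4rel.sadj at h; revert i j; decide)
  case rre i j h =>
    simpa [hR, hE, mul_assoc] using key (r := ⟨[j, i, j + 4], [i + 4, j + 4], 0⟩)
      (by unfold BrF4rel.sadj at h; revert i j; decide)
  case rer i j h =>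
    simpa [hR, hE, mul_assoc] using key (r := ⟨[i, j + 4, i], [j, i + 4, j], 0⟩)
      (by unfold BrF4rel.sadj at h; revert i j; decide)
  case db1 => simpa [hR, mul_assoc] using key (r := ⟨[1, 2, 1, 2], [2, 1, 2, 1], 0⟩) (by decide)
  case db2 => simpa [hR, hE, mul_assoc] using key (r := ⟨[1, 2, 5], [2, 5], 0⟩) (by decide)
  case db3 =>
    simpa [hR, hE, mul_assoc] using key (r := ⟨[1, 6, 1, 6], [6, 5, 6], 0⟩) (by decide)
  case db4 =>
    simpa [hR, hE, mul_assoc] using key (r := ⟨[1, 2, 1, 6], [6, 1, 2, 1], 0⟩) (by decide)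
  case db5 => simpa [hR, hE, mul_assoc] using key (r := ⟨[5, 2, 5], [5], 1⟩) (by decide)
  case db6 => simpa [hE, mul_assoc] using key (r := ⟨[5, 6, 5], [5], 1⟩) (by decide)
  case db7 => simpa [hR, hE, mul_assoc] using key (r := ⟨[5, 2, 1], [5, 2], 0⟩) (by decide)
  case db8 => simpa [hR, hE, mul_assoc] using key (r := ⟨[5, 6, 1], [5, 6], 0⟩) (by decide)

/-- The representation of `BrF4` on the span of the pairs of points. -/
noncomputable def rep : BrF4 →ₐ[Rring]
    Module.End Rring (({X // X ∈ points} × {X // X ∈ points}) →₀ Rring) :=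
  RingQuot.liftAlgHom Rring ⟨freeRep, fun _ _ h ↦ freeRep_rel h⟩

theorem rep_rgen (i : Fin 4) : rep (rgen i) = WeightedMap.op (actPairs i) :=
  (RingQuot.liftAlgHom_mkAlgHom_apply _ _ _ _).trans (FreeAlgebra.lift_ι_apply _ _)

theorem rep_egen (i : Fin 4) : rep (egen i) = WeightedMap.op (actPairs (i + 4)) :=
  (RingQuot.liftAlgHom_mkAlgHom_apply _ _ _ _).trans (FreeAlgebra.lift_ι_apply _ _)

/-! ### Leading terms -/

/-- The number of the letter of `BrF4` corresponding to a letter of `BrC3`. -/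
def f4OfC3 : ℕ → ℕ
  | 0 => 0
  | 1 => 1
  | 2 => 2
  | 3 => 4
  | 4 => 5
  | _ => 6

theorem map_word_actPairs (w : List ℕ) (z : {X // X ∈ points} × {X // X ∈ points}) :
    (WeightedMap.word (fun g ↦ actPairs (f4OfC3 g)) w z).map
      (fun p ↦ (p.1, p.2.1.1, p.2.2.1)) = image w (z.1.1, z.2.1) := by
  have hact : c3Act = fun g ↦ act (f4OfC3 g) := by
    funext g
    unfold c3Act f4OfC3
    split <;> rfl
  have h (x : {X // X ∈ points}) :
      (WeightedMap.word (fun g ↦ actPoints (f4OfC3 g)) w x).map (fun p ↦ (p.1, p.2.1)) =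
        WeightedMap.word c3Act w x.1 := by
    rw [hact]
    exact WeightedMap.map_word_restrict (fun g ↦ act (f4OfC3 g))
      (fun g ↦ mem_points_of_act (f4OfC3 g)) w x
  simp only [actPairs, WeightedMap.word_pair, image, WeightedMap.pair, ← h]
  cases WeightedMap.word (fun g ↦ actPoints (f4OfC3 g)) w z.1 <;>
    cases WeightedMap.word (fun g ↦ actPoints (f4OfC3 g)) w z.2 <;> rfl

theorem eqTarget_comm (p q : Option (ℕ × ℕ × ℕ)) : eqTarget p q = eqTarget q p := by
  have hbeq (m n : ℕ) : Nat.beq m n = Nat.beq n m := by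
    rw [Bool.eq_iff_iff, Nat.beq_eq, Nat.beq_eq, eq_comm]
  cases p <;> cases q <;> simp only [eqTarget, hbeq]

theorem pairwise_of_distinct {l : List (Option (ℕ × ℕ × ℕ))} (h : distinct l = true) :
    l.Pairwise fun p q ↦ eqTarget p q = false := by
  induction l with
  | nil => exact List.Pairwise.nil
  | cons p l ih =>
    obtain ⟨h₁, h₂⟩ := Bool.and_eq_true_iff.mp h
    refine List.Pairwise.cons (fun q hq ↦ ?_) (ih h₂)
    simpa using List.all_eq_true.mp h₁ q hq

/-- Every word `j` in `c3Basis` has a leading term that no other word in `c3Basis` has. -/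
theorem exists_probe {j : List ℕ} (hj : j ∈ c3Basis) :
    ∃ (m : ℕ) (z : {X // X ∈ points} × {X // X ∈ points}) (y : ℕ × ℕ),
      image j (z.1.1, z.2.1) = some (m, y) ∧
      ∀ i ∈ c3Basis, i ≠ j → ∀ p, image i (z.1.1, z.2.1) = some p → p.2 = y → p.1 < m := by
  obtain ⟨hmem, hlead⟩ := Bool.and_eq_true_iff.mp image_c3Basis
  obtain ⟨hmax, hex⟩ := Bool.and_eq_true_iff.mp hlead
  obtain ⟨⟨m, X, Y⟩, hq, hjq⟩ := List.any_eq_true.mp (List.all_eq_true.mp hex j hj)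
  obtain ⟨hX, hY⟩ := Bool.and_eq_true_iff.mp (List.all_eq_true.mp hmem _ hq)
  obtain ⟨hle, hdist⟩ := Bool.and_eq_true_iff.mp (List.all_eq_true.mp hmax _ hq)
  cases hy : image j (X, Y) with
  | none => simp [hy, expEq] at hjq
  | some y =>
    have hym : y.1 = m := by
      rw [hy] at hjq
      exact Nat.eq_of_beq_eq_true hjq
    refine ⟨m, (⟨X, mem_of_memNat hX⟩, ⟨Y, mem_of_memNat hY⟩), y.2, by rw [← hym]; exact hy,
      fun i hi hij p hp hpy ↦ ?_⟩
    have hpm := List.all_eq_true.mp hle i hi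
    change image i (X, Y) = some p at hp
    simp only [hp] at hpm
    refine lt_of_le_of_ne (Nat.le_of_ble_eq_true hpm) fun hpm ↦ ?_
    have : Std.Symm fun v w ↦ eqTarget (image v (X, Y)) (image w (X, Y)) = false :=
      ⟨fun v w h ↦ by rwa [eqTarget_comm]⟩
    have hne := (List.pairwise_map.mp (pairwise_of_distinct hdist)).forall
      (List.mem_filter.mpr ⟨hi, by simp [hp, expEq, hpm]⟩) (List.mem_filter.mpr ⟨hj, hjq⟩) hij
    simp [hp, hy, eqTarget, hpy] at hne

end E6

open E6 in
/-- The images of the words in `c3Basis` under the representation of `BrF4` are independent. -/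
theorem eq_zero_of_sum_op_word (c : c3Basis.toFinset → Rring)
    (h : ∑ w, c w • WeightedMap.op (WeightedMap.word (fun g ↦ actPairs (f4OfC3 g)) w) = 0) :
    ∀ w, c w = 0 := by
  refine eq_zero_of_leading_terms c fun j ↦ ?_
  obtain ⟨m, z, y, hjy, hlead⟩ := exists_probe (List.mem_toFinset.mp j.2)
  rw [← map_word_actPairs] at hjy
  obtain ⟨p, hp, hpy⟩ := Option.map_eq_some_iff.mp hjy
  obtain ⟨rfl, rfl⟩ := Prod.mk.inj hpy
  refine ⟨p.1, fun w ↦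
    WeightedMap.vec (WeightedMap.word (fun g ↦ actPairs (f4OfC3 g)) w z) p.2, ?_, ?_, ?_⟩
  · simp [hp, WeightedMap.vec]
  · intro i hij
    cases hq : WeightedMap.word (fun g ↦ actPairs (f4OfC3 g)) i z with
    | none => exact .inl (by simp [hq, WeightedMap.vec])
    | some q =>
      by_cases hqp : q.2 = p.2
      · refine .inr ⟨q.1, hlead i (List.mem_toFinset.mp i.2)
          (Subtype.coe_ne_coe.mpr hij) (q.1, q.2.1.1, q.2.2.1) ?_ ?_, ?_⟩
        · rw [← map_word_actPairs, hq]
          rfl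
        · rw [hqp]
        · simp [hq, WeightedMap.vec, hqp]
      · exact .inl (by simp [hq, WeightedMap.vec, Finsupp.single_eq_of_ne' hqp])
  · have hz := congr_arg (fun f ↦ f (Finsupp.single z 1) p.2) h
    simpa [WeightedMap.op_single, LinearMap.sum_apply, Finsupp.finsetSum_apply] using hz

/-! ### The homomorphism -/

/-- The images of the generators of `BrC3` in `BrF4`, on the free algebra. -/
noncomputable def freeHom : FreeAlgebra Rring GenC3 →ₐ[Rring] BrF4 :=
  FreeAlgebra.lift Rring fun
    | .x i => rgen i.castSucc
    | .f i => egen i.castSucc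

theorem freeHom_rel {a b : FreeAlgebra Rring GenC3} (h : BrC3rel.rel a b) :
    freeHom a = freeHom b := by
  have key {a b : FreeAlgebra Rring GenF4} (h : BrF4rel.rel a b) :=
    RingQuot.mkAlgHom_rel Rring h
  have hX (i : Fin 3) : freeHom (BrC3rel.X i) = rgen i.castSucc := FreeAlgebra.lift_ι_apply _ _
  have hF (i : Fin 3) : freeHom (BrC3rel.F i) = egen i.castSucc := FreeAlgebra.lift_ι_apply _ _
  cases h <;> simp only [map_mul, map_smul, map_one, hX, hF, rgen, egen] <;>
    simp only [← map_mul, ← map_smul, ← map_one (RingQuot.mkAlgHom Rring BrF4rel.rel)]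
  case xx i => exact key (.rr _)
  case xf i => exact key (.re _)
  case fx i => exact key (.er _)
  case ff_short => exact key (.ee_short 2 (by decide))
  case ff_long0 => exact key (.ee_long 0 (by decide))
  case ff_long1 => exact key (.ee_long 1 (by decide))
  case nxx => exact key (.rr_comm (i := 0) (j := 2) (by simp [BrF4rel.nadj]))
  case nfx => exact key (.er_comm (i := 0) (j := 2) (by simp [BrF4rel.nadj]))
  case nxf => exact key (.er_comm (i := 2) (j := 0) (by simp [BrF4rel.nadj]))
  case nff => exact key (.ee_comm (i := 0) (j := 2) (by simp [BrF4rel.nadj]))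
  case braid => exact key (.braid (i := 0) (j := 1) (by simp [BrF4rel.sadj]))
  case rre01 => exact key (.rre (i := 0) (j := 1) (by simp [BrF4rel.sadj]))
  case rre10 => exact key (.rre (i := 1) (j := 0) (by simp [BrF4rel.sadj]))
  case rer01 => exact key (.rer (i := 0) (j := 1) (by simp [BrF4rel.sadj]))
  case db1 => exact key .db1
  case db2 => exact key .db2
  case db3 => exact key .db3
  case db4 => exact key .db4
  case db5 => exact key .db5
  case db6 => exact key .db6
  case db7 => exact key .db7
  case db8 => exact key .db8

/-- The canonical homomorphism from `BrC3` to `BrF4`. -/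
noncomputable def brC3ToBrF4 : BrC3 →ₐ[Rring] BrF4 :=
  RingQuot.liftAlgHom Rring ⟨freeHom, fun _ _ h ↦ freeHom_rel h⟩

theorem brC3ToBrF4_xgen (i : Fin 3) : brC3ToBrF4 (xgen i) = rgen i.castSucc :=
  (RingQuot.liftAlgHom_mkAlgHom_apply _ _ _ _).trans (FreeAlgebra.lift_ι_apply _ _)

theorem brC3ToBrF4_fgen (i : Fin 3) : brC3ToBrF4 (fgen i) = egen i.castSucc :=
  (RingQuot.liftAlgHom_mkAlgHom_apply _ _ _ _).trans (FreeAlgebra.lift_ι_apply _ _)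

theorem rep_c3Letter (a : ℕ) :
    E6.rep (brC3ToBrF4 (c3Letter a)) = WeightedMap.op (E6.actPairs (E6.f4OfC3 a)) := by
  unfold c3Letter E6.f4OfC3
  split <;> simp only [brC3ToBrF4_xgen, brC3ToBrF4_fgen, E6.rep_rgen, E6.rep_egen] <;> rfl

theorem rep_wordProd (w : List ℕ) :
    E6.rep (brC3ToBrF4 (wordProd c3Letter w)) =
      WeightedMap.op (WeightedMap.word (fun g ↦ E6.actPairs (E6.f4OfC3 g)) w) := by
  rw [← WeightedMap.wordProd_op]
  induction w with
  | nil => simp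
  | cons a w ih => rw [wordProd_cons, wordProd_cons, map_mul, map_mul, ih, rep_c3Letter]

theorem brC3ToBrF4_injective : Function.Injective brC3ToBrF4 := by
  refine (injective_iff_map_eq_zero _).mpr fun b hb ↦ ?_
  have hspan : b ∈ Submodule.span Rring
      (wordProd c3Letter '' (c3Basis.toFinset : Set (List ℕ))) := by
    rw [List.coe_toFinset, span_c3Basis]
    trivial
  obtain ⟨c, rfl⟩ := (Submodule.mem_span_image_finset_iff_exists_fun Rring).mp hspan
  have hzero := congr_arg E6.rep hb
  simp only [map_sum, map_smul, rep_wordProd, map_zero] at hzero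
  exact Finset.sum_eq_zero fun w _ ↦ by rw [eq_zero_of_sum_op_word c hzero w, zero_smul]

/-- The canonical homomorphism `Br(C₃) → Br(F₄)`, `x_i ↦ r_i`, `f_i ↦ e_i`
(`i = 1,2,3`, here 0-based `0,1,2`), is injective. -/
theorem brC3_to_brF4_injective :
    ∃ ψ : BrC3 →ₐ[Rring] BrF4,
      (∀ i : Fin 3, ψ (xgen i) = rgen (Fin.castSucc i)) ∧
      (∀ i : Fin 3, ψ (fgen i) = egen (Fin.castSucc i)) ∧
      Function.Injective ψ :=
  ⟨brC3ToBrF4, brC3ToBrF4_xgen, brC3ToBrF4_fgen, brC3ToBrF4_injective⟩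
end
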